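/- There exists a constant C > 0 such that for every x ∈ [−1,1] with x ≠ 0 and every integer n ≥ 0, |F_{1,n}(x) − e^{σ(x)iπ/4} |x|^{1/2} F_{1,⌊n|x|⌋}(−1/x, 0) − Ω_1(x)| ≤ C · min( 1/((n+1) √|x|), 1 + |log((n+1) √|x|)| ). -/

import Mathlib

open Complex Filter Finset

noncomputable section

/-- `ρ = e^{iπ/4}`. -/
def ρ : ℂ := Complex.exp (Real.pi * Complex.I / 4)

/-- Partial sum `F_{s,n}(x,t) = Σ_{k=1}^{n} e^{iπk²x + 2πikt}/k^s`. -/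
def Fpart (s : ℝ) (n : ℕ) (x t : ℝ) : ℂ :=
  ∑ k ∈ Finset.Icc 1 n,
    Complex.exp (Real.pi * Complex.I * (k : ℂ) ^ 2 * (x : ℂ)
        + 2 * Real.pi * Complex.I * (k : ℂ) * (t : ℂ)) / (k : ℂ) ^ (s : ℂ)

/-- The function `I_s(x,t)` (for `x > 0`). -/
def Ifun (s x t : ℝ) : ℂ :=
  (∫ u : ℝ, ρ *
      (Complex.exp (Real.pi * Complex.I * ((1 : ℂ) / 2 + ρ * (u : ℂ)) ^ 2 * (x : ℂ)
            + 2 * Real.pi * Complex.I * ((1 : ℂ) / 2 + ρ * (u : ℂ)) * (Int.fract t : ℝ)) /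
        (((1 : ℂ) / 2 + ρ * (u : ℂ)) ^ (s : ℂ) *
          (1 - Complex.exp (2 * Real.pi * Complex.I * ((1 : ℂ) / 2 + ρ * (u : ℂ)))))))
  + ρ * (x : ℂ) ^ (s : ℂ) *
    ∫ u : ℝ, (Real.exp (-(Real.pi * x * u ^ 2)) : ℝ) *
      ∑' k : ℕ, Complex.exp (-(Real.pi * Complex.I * (((k : ℂ) + 1) - (Int.fract t : ℝ)) ^ 2 / (x : ℂ))) *
        (((ρ * (x : ℂ) * (u : ℂ) + ((k : ℂ) + 1) - (Int.fract t : ℝ)) ^ (s : ℂ))⁻¹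
          - (((k : ℂ) + 1) ^ (s : ℂ))⁻¹)

/-- `Ω_s(x,t)`. -/
def Omega (s x t : ℝ) : ℂ :=
  if 0 < x then Ifun s x t else (starRingEnd ℂ) (Ifun s (-x) (-t))

/-- `Ω_s(x) = Ω_s(x,0)`. -/
def Omega0 (s x : ℝ) : ℂ := Omega s x 0

/-- The map `T(x) = -1/x mod 2`, valued in `(-1,1]`. -/
def Tmap (x : ℝ) : ℝ := -1 / x - 2 * ⌈((-1 / x) - 1) / 2⌉

/-- Denominator `Q_n` of the `n`-th convergent of the regular continued fraction of `x`. -/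
def Qden (x : ℝ) (n : ℕ) : ℝ := (GenContFract.of x).dens n

end

open MeasureTheory Topology

theorem integral_inv_sub_inv_horizontal {c : ℝ} (hc : 0 < c) :
    Integrable (fun u : ℝ => ((u : ℂ) + ((-c : ℝ) : ℂ) * I)⁻¹ - ((u : ℂ) + (c : ℂ) * I)⁻¹) ∧
    ∫ u : ℝ, (((u : ℂ) + ((-c : ℝ) : ℂ) * I)⁻¹ - ((u : ℂ) + (c : ℂ) * I)⁻¹)
      = 2 * Real.pi * I := by
  have key : ∀ u : ℝ, ((u : ℂ) + ((-c : ℝ) : ℂ) * I)⁻¹ - ((u : ℂ) + (c : ℂ) * I)⁻¹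
      = (2 * I / c) * (((1 + (u / c) ^ 2)⁻¹ : ℝ) : ℂ) := by
    intro u
    have h1 : (u : ℂ) + ((-c : ℝ) : ℂ) * I ≠ 0 := by
      intro h; have := congrArg Complex.im h; simp at this; exact hc.ne' this
    have h2 : (u : ℂ) + (c : ℂ) * I ≠ 0 := by
      intro h; have := congrArg Complex.im h; simp at this; exact hc.ne' this
    have h3 : (c : ℂ) ≠ 0 := by exact_mod_cast hc.ne'
    have h4 : (1 + ((u : ℂ) / c) ^ 2) ≠ 0 := by
      have : (1 + (u / c) ^ 2) ≠ 0 := by positivity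
      exact_mod_cast this
    have h5 : (1 + ((u : ℂ) / c) ^ 2) = ((u : ℂ) + ((-c : ℝ) : ℂ) * I) * ((u : ℂ) + (c : ℂ) * I)
        / c ^ 2 := by
      push_cast
      field_simp
      ring_nf
      rw [I_sq]; ring
    push_cast at h5 ⊢
    rw [h5]
    push_cast at h1
    rw [inv_div, inv_sub_inv h1 h2, div_mul_div_comm,
      div_eq_div_iff (mul_ne_zero h1 h2) (mul_ne_zero h3 (mul_ne_zero h1 h2))]
    ring
  have hi : Integrable (fun u : ℝ => (1 + (u / c) ^ 2)⁻¹) :=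
    integrable_inv_one_add_sq.comp_div hc.ne'
  constructor
  · simp_rw [key]
    exact (hi.ofReal (𝕜 := ℂ)).const_mul _
  · simp_rw [key]
    rw [integral_const_mul, integral_complex_ofReal,
      Measure.integral_comp_div (fun u : ℝ => (1 + u ^ 2)⁻¹) c, integral_univ_inv_one_add_sq]
    have h3 : (c : ℂ) ≠ 0 := by exact_mod_cast hc.ne'
    rw [abs_of_pos hc]
    simp
    field_simp

/-- Residue theorem on a horizontal strip, for a simple pole at the origin. -/
theorem integral_strip_residue {c : ℝ} (hc : 0 < c) {φ f : ℂ → ℂ}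
    (hφ : ∀ w : ℂ, |w.im| ≤ c → DifferentiableAt ℂ φ w)
    (hf : ∀ w : ℂ, |w.im| ≤ c → w ≠ 0 → f w = φ w / w)
    {b : ℝ → ℝ} (hb : Tendsto b atTop (𝓝 0))
    (hfb : ∀ᶠ R in atTop, ∀ w : ℂ, |w.im| ≤ c → |w.re| = R → ‖f w‖ ≤ b R)
    (h1 : Integrable fun u : ℝ => f ((u : ℂ) + ((-c : ℝ) : ℂ) * I))
    (h2 : Integrable fun u : ℝ => f ((u : ℂ) + (c : ℂ) * I)) :
    (∫ u : ℝ, f ((u : ℂ) + ((-c : ℝ) : ℂ) * I)) - ∫ u : ℝ, f ((u : ℂ) + (c : ℂ) * I)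
      = 2 * Real.pi * I * φ 0 := by
  set S : Set ℂ := {w | |w.im| ≤ c} with hS
  have hS0 : S ∈ 𝓝 (0 : ℂ) := by
    have : Tendsto (fun w : ℂ => |w.im|) (𝓝 0) (𝓝 0) := by
      have : Continuous (fun w : ℂ => |w.im|) := by fun_prop
      simpa using this.tendsto 0
    filter_upwards [this.eventually (gt_mem_nhds hc)] with w hw using le_of_lt hw
  set h := dslope φ 0 with hh
  have hd : DifferentiableOn ℂ h S :=
    (Complex.differentiableOn_dslope hS0).2 fun w hw => (hφ w hw).differentiableWithinAt
  have heq : ∀ w : ℂ, |w.im| ≤ c → w ≠ 0 → h w = f w - φ 0 * w⁻¹ := by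
    intro w hw hw0
    rw [hh, dslope_of_ne _ hw0, slope_def_field, hf w hw hw0]
    field_simp
    ring
  have hline : ∀ y : ℝ, |y| = c → ∀ u : ℝ, (u : ℂ) + (y : ℂ) * I ≠ 0 := by
    intro y hy u hu
    have := congrArg Complex.im hu
    simp at this
    rw [this] at hy; simp at hy; exact hc.ne hy
  have hcc : |(-c : ℝ)| = c := by rw [abs_neg, abs_of_pos hc]
  have hcc' : |c| = c := abs_of_pos hc
  obtain ⟨hPi, hPv⟩ := integral_inv_sub_inv_horizontal hc
  have hcont : ∀ y : ℝ, |y| = c → Continuous fun u : ℝ => ((u : ℂ) + (y : ℂ) * I)⁻¹ := by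
    intro y hy
    exact Continuous.inv₀ (by fun_prop) (hline y hy)
  have hside : ∀ y : ℝ, |y| = c → Integrable (fun u : ℝ => f ((u : ℂ) + (y : ℂ) * I)) → ∀ R : ℝ,
      ∫ u in (-R)..R, h ((u : ℂ) + (y : ℂ) * I) = (∫ u in (-R)..R, f ((u : ℂ) + (y : ℂ) * I))
        - φ 0 * ∫ u in (-R)..R, ((u : ℂ) + (y : ℂ) * I)⁻¹ := by
    intro y hy hi R
    rw [← intervalIntegral.integral_const_mul, ← intervalIntegral.integral_sub]
    · refine intervalIntegral.integral_congr fun u _ => ?_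
      exact heq _ (by simp [hy]) (hline y hy u)
    · exact hi.intervalIntegrable
    · exact ((hcont y hy).intervalIntegrable _ _).const_mul _
  have hrect : ∀ R : ℝ,
      ((∫ u in (-R)..R, f ((u : ℂ) + ((-c : ℝ) : ℂ) * I)) - ∫ u in (-R)..R, f ((u : ℂ) + (c : ℂ) * I))
      - φ 0 * (∫ u in (-R)..R,
          (((u : ℂ) + ((-c : ℝ) : ℂ) * I)⁻¹ - ((u : ℂ) + (c : ℂ) * I)⁻¹))
      = I • (∫ y in (-c)..c, h (((-R : ℝ) : ℂ) + y * I))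
        - I • (∫ y in (-c)..c, h ((R : ℂ) + y * I)) := by
    intro R
    have := Complex.integral_boundary_rect_eq_zero_of_differentiableOn h
      (((-R : ℝ) : ℂ) + ((-c : ℝ) : ℂ) * I) ((R : ℂ) + (c : ℂ) * I) (by
        refine hd.mono fun w hw => ?_
        have := hw.2
        simp only [add_im, ofReal_im, mul_im, ofReal_re, I_im, I_re, mul_one, mul_zero, add_zero,
          zero_add, Set.mem_preimage] at this
        rw [Set.uIcc_of_le (by linarith)] at this
        exact abs_le.2 this)
    simp only [add_im, add_re, mul_re, ofReal_im, mul_im, ofReal_re, I_im, I_re, mul_one, mul_zero,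
      add_zero, zero_add, sub_zero] at this
    rw [hside (-c) hcc h1, hside c hcc' h2] at this
    rw [intervalIntegral.integral_sub ((hcont _ hcc).intervalIntegrable _ _)
      ((hcont _ hcc').intervalIntegrable _ _)]
    linear_combination this
  have hsidebound : ∀ᶠ R in atTop, ∀ s : ℝ, |s| = R →
      ‖∫ y in (-c)..c, h ((s : ℂ) + y * I)‖ ≤ (b R + ‖φ 0‖ * R⁻¹) * (2 * c) := by
    filter_upwards [hfb, eventually_gt_atTop 0] with R hR hR0 s hs
    have : ∀ y ∈ Set.uIoc (-c) c, ‖h ((s : ℂ) + y * I)‖ ≤ b R + ‖φ 0‖ * R⁻¹ := by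
      intro y hy
      rw [Set.uIoc_of_le (by linarith)] at hy
      have hy' : |((s : ℂ) + y * I).im| ≤ c := by
        simpa using abs_le.2 ⟨hy.1.le, hy.2⟩
      have hre : |((s : ℂ) + y * I).re| = R := by simpa using hs
      have hn : R ≤ ‖(s : ℂ) + y * I‖ := hre ▸ Complex.abs_re_le_norm _
      have h0 : (s : ℂ) + y * I ≠ 0 := by
        intro h0; rw [h0] at hn; simp at hn; linarith
      rw [heq _ hy' h0]
      refine (norm_sub_le _ _).trans (add_le_add (hR _ hy' hre) ?_)
      rw [norm_mul, norm_inv]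
      gcongr
    refine (intervalIntegral.norm_integral_le_of_norm_le_const this).trans (le_of_eq ?_)
    rw [abs_of_pos (by linarith)]; ring
  have hlim0 : Tendsto (fun R => (b R + ‖φ 0‖ * R⁻¹) * (2 * c)) atTop (𝓝 0) := by
    have := ((hb.add (tendsto_inv_atTop_zero.const_mul ‖φ 0‖)).mul_const (2 * c))
    simpa using this
  have hr : Tendsto (fun R : ℝ => ∫ y in (-c)..c, h ((R : ℂ) + y * I)) atTop (𝓝 0) := by
    refine squeeze_zero_norm' ?_ hlim0
    filter_upwards [hsidebound, eventually_gt_atTop 0] with R hR hR0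
    exact hR R (abs_of_pos hR0)
  have hl : Tendsto (fun R : ℝ => ∫ y in (-c)..c, h (((-R : ℝ) : ℂ) + y * I)) atTop (𝓝 0) := by
    refine squeeze_zero_norm' ?_ hlim0
    filter_upwards [hsidebound, eventually_gt_atTop 0] with R hR hR0
    exact hR (-R) (by rw [abs_neg, abs_of_pos hR0])
  have hL := ((intervalIntegral_tendsto_integral h1 tendsto_neg_atTop_atBot tendsto_id).sub
    (intervalIntegral_tendsto_integral h2 tendsto_neg_atTop_atBot tendsto_id)).sub
    ((intervalIntegral_tendsto_integral hPi tendsto_neg_atTop_atBot tendsto_id).const_mul (φ 0))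
  have hR := (hl.const_smul I).sub (hr.const_smul I)
  have := tendsto_nhds_unique (hL.congr fun R => hrect R) hR
  rw [hPv] at this
  simp only [smul_zero, sub_zero] at this
  linear_combination this

theorem rho_eq : ρ = ((Real.sqrt 2 / 2 : ℝ) : ℂ) + ((Real.sqrt 2 / 2 : ℝ) : ℂ) * I := by
  have : (Real.pi * I / 4 : ℂ) = ((Real.pi / 4 : ℝ) : ℂ) * I := by push_cast; ring
  rw [ρ, this, exp_mul_I, ← ofReal_cos, ← ofReal_sin, Real.cos_pi_div_four, Real.sin_pi_div_four]

theorem rho_ne_zero : ρ ≠ 0 := exp_ne_zero _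

theorem sqrt_two_mul_self : Real.sqrt 2 * Real.sqrt 2 = 2 := Real.mul_self_sqrt (by norm_num)

theorem rho_mul_I : ρ * I = ρ - ((Real.sqrt 2 : ℝ) : ℂ) := by
  rw [rho_eq]; apply Complex.ext <;> simp
  ring

theorem rho_sq : ρ ^ 2 = I := by
  rw [ρ, ← Complex.exp_nat_mul]
  have : ((2 : ℕ) * (Real.pi * I / 4) : ℂ) = Real.pi / 2 * I := by push_cast; ring
  rw [this, exp_pi_div_two_mul_I]

theorem norm_rho : ‖ρ‖ = 1 := by
  have : (Real.pi * I / 4 : ℂ) = ((Real.pi / 4 : ℝ) : ℂ) * I := by push_cast; ring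
  rw [ρ, this, norm_exp_ofReal_mul_I]

theorem line_re (a u : ℝ) : ((a : ℂ) + ρ * u).re = a + Real.sqrt 2 / 2 * u := by
  rw [rho_eq]; simp

theorem line_im (a u : ℝ) : ((a : ℂ) + ρ * u).im = Real.sqrt 2 / 2 * u := by
  rw [rho_eq]; simp

/-- Residue theorem on a strip in the direction `ρ`, for a simple pole on its middle line. -/
theorem integral_slanted_residue {a d : ℝ} (hd : 0 < d) {φ f : ℂ → ℂ}
    (hφ : ∀ z : ℂ, |z.re - z.im - a| ≤ d → DifferentiableAt ℂ φ z)
    (hf : ∀ z : ℂ, |z.re - z.im - a| ≤ d → z ≠ a → f z = φ z / (z - a))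
    {K : ℝ} (hfb : ∀ z : ℂ, |z.re - z.im - a| ≤ d → 1 ≤ |z.im| →
      ‖f z‖ ≤ K * Real.exp (-|z.im|))
    (h1 : Integrable fun u : ℝ => f (((a - d : ℝ) : ℂ) + ρ * u))
    (h2 : Integrable fun u : ℝ => f (((a + d : ℝ) : ℂ) + ρ * u)) :
    ρ * (∫ u : ℝ, f (((a + d : ℝ) : ℂ) + ρ * u)) - ρ * ∫ u : ℝ, f (((a - d : ℝ) : ℂ) + ρ * u)
      = 2 * Real.pi * I * φ a := by
  have hs2 : 0 < Real.sqrt 2 := by positivity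
  have hss := sqrt_two_mul_self
  set c : ℝ := d * (Real.sqrt 2 / 2) with hc
  have hc0 : 0 < c := by positivity
  have hcd : Real.sqrt 2 * c = d := by rw [hc]; linear_combination d / 2 * hss
  have him : ∀ w : ℂ, ((a : ℂ) + ρ * w).im = Real.sqrt 2 / 2 * (w.re + w.im) := by
    intro w; rw [rho_eq]; simp; ring
  have hre : ∀ w : ℂ, ((a : ℂ) + ρ * w).re - ((a : ℂ) + ρ * w).im - a = - Real.sqrt 2 * w.im := by
    intro w; rw [rho_eq]; simp; ring
  have hstrip : ∀ w : ℂ, |w.im| ≤ c →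
      |((a : ℂ) + ρ * w).re - ((a : ℂ) + ρ * w).im - a| ≤ d := by
    intro w hw
    rw [hre, abs_mul, abs_neg, abs_of_pos hs2, ← hcd]
    gcongr
  have e1 : ∀ u : ℝ, (a : ℂ) + ρ * ((u : ℂ) + ((-c : ℝ) : ℂ) * I)
      = ((a + d : ℝ) : ℂ) + ρ * ((u - c : ℝ) : ℂ) := by
    intro u
    rw [← hcd]; push_cast
    linear_combination (-(c : ℂ)) * rho_mul_I
  have e2 : ∀ u : ℝ, (a : ℂ) + ρ * ((u : ℂ) + (c : ℂ) * I)
      = ((a - d : ℝ) : ℂ) + ρ * ((u + c : ℝ) : ℂ) := by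
    intro u
    rw [← hcd]; push_cast
    linear_combination (c : ℂ) * rho_mul_I
  have main := integral_strip_residue hc0 (φ := fun w => φ (a + ρ * w) / ρ)
    (f := fun w => f (a + ρ * w))
    (b := fun R => K * Real.exp (-(Real.sqrt 2 / 2 * (R - c))))
    (fun w hw => by
      have := hφ _ (hstrip w hw)
      refine DifferentiableAt.div_const ?_ _
      exact DifferentiableAt.comp w (f := fun w : ℂ => (a : ℂ) + ρ * w) this (by fun_prop))
    (fun w hw hw0 => by
      have hne : (a : ℂ) + ρ * w ≠ a := by
        simpa using ⟨rho_ne_zero, hw0⟩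
      rw [hf _ (hstrip w hw) hne, div_div]
      congr 1; ring)
    (by
      have : Tendsto (fun R : ℝ => Real.sqrt 2 / 2 * (R - c)) atTop atTop :=
        Tendsto.const_mul_atTop (by positivity) (tendsto_atTop_add_const_right _ _ tendsto_id)
      simpa using (Real.tendsto_exp_neg_atTop_nhds_zero.comp this).const_mul K)
    (by
      have h1 : ∀ᶠ R : ℝ in atTop, 1 ≤ Real.sqrt 2 / 2 * (R - c) := by
        have : Tendsto (fun R : ℝ => Real.sqrt 2 / 2 * (R - c)) atTop atTop :=
          Tendsto.const_mul_atTop (by positivity) (tendsto_atTop_add_const_right _ _ tendsto_id)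
        exact this.eventually (eventually_ge_atTop 1)
      filter_upwards [h1] with R hR w hw hwR
      have hlow : Real.sqrt 2 / 2 * (R - c) ≤ |((a : ℂ) + ρ * w).im| := by
        rw [him, abs_mul, abs_of_pos (by positivity : 0 < Real.sqrt 2 / 2)]
        gcongr
        have := abs_sub_abs_le_abs_sub w.re (-w.im)
        rw [abs_neg, sub_neg_eq_add] at this
        linarith
      have hb := hfb _ (hstrip w hw) (hR.trans hlow)
      have hK : 0 ≤ K := by
        by_contra hK
        have := mul_neg_of_neg_of_pos (not_le.1 hK) (Real.exp_pos (-|((a : ℂ) + ρ * w).im|))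
        linarith [norm_nonneg (f ((a : ℂ) + ρ * w))]
      refine hb.trans ?_
      gcongr)
    (by simp_rw [e1]; exact h2.comp_sub_right c)
    (by simp_rw [e2]; exact h1.comp_add_right c)
  simp_rw [e1, e2] at main
  rw [integral_sub_right_eq_self (fun u : ℝ => f (((a + d : ℝ) : ℂ) + ρ * u)) c,
    integral_add_right_eq_self (fun u : ℝ => f (((a - d : ℝ) : ℂ) + ρ * u)) c] at main
  rw [← mul_sub, main]
  have := rho_ne_zero
  field_simp
  simp

/-- A line of direction `ρ` can be moved across a region of holomorphy. -/
theorem integral_slanted_eq {a₁ a₂ : ℝ} (h : a₁ ≤ a₂) {f : ℂ → ℂ}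
    (hf : ∀ z : ℂ, a₁ ≤ z.re - z.im → z.re - z.im ≤ a₂ → DifferentiableAt ℂ f z)
    {K : ℝ} (hfb : ∀ z : ℂ, a₁ ≤ z.re - z.im → z.re - z.im ≤ a₂ → 1 ≤ |z.im| →
      ‖f z‖ ≤ K * Real.exp (-|z.im|))
    (h1 : Integrable fun u : ℝ => f ((a₁ : ℂ) + ρ * u))
    (h2 : Integrable fun u : ℝ => f ((a₂ : ℂ) + ρ * u)) :
    ∫ u : ℝ, f ((a₁ : ℂ) + ρ * u) = ∫ u : ℝ, f ((a₂ : ℂ) + ρ * u) := by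
  rcases h.eq_or_lt with rfl | hlt
  · rfl
  have e1 : a₁ = (a₁ + a₂) / 2 - (a₂ - a₁) / 2 := by ring
  have e2 : a₂ = (a₁ + a₂) / 2 + (a₂ - a₁) / 2 := by ring
  have hz : ∀ z : ℂ, |z.re - z.im - (a₁ + a₂) / 2| ≤ (a₂ - a₁) / 2 →
      a₁ ≤ z.re - z.im ∧ z.re - z.im ≤ a₂ := by
    intro z hz
    have := abs_le.1 hz
    constructor <;> linarith [this.1, this.2]
  have := integral_slanted_residue (a := (a₁ + a₂) / 2) (d := (a₂ - a₁) / 2) (by linarith)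
    (φ := fun z => f z * (z - ((a₁ + a₂) / 2 : ℝ))) (f := f)
    (fun z hh => (hf z (hz z hh).1 (hz z hh).2).mul (by fun_prop))
    (fun z hh hne => by
      have := sub_ne_zero.2 hne
      field_simp)
    (fun z hh => hfb z (hz z hh).1 (hz z hh).2)
    (by rw [← e1]; exact h1) (by rw [← e2]; exact h2)
  rw [← e1, ← e2] at this
  simp only [sub_self, mul_zero] at this
  exact (mul_left_cancel₀ rho_ne_zero (sub_eq_zero.1 this)).symm

/-- The phase `e^{iπz²x - 2πikz}`. -/
noncomputable def phase (x : ℝ) (k : ℕ) (z : ℂ) : ℂ :=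
  exp (Real.pi * I * z ^ 2 * x - 2 * Real.pi * I * k * z)

theorem phase_differentiable (x : ℝ) (k : ℕ) : Differentiable ℂ (phase x k) := by
  unfold phase; fun_prop

theorem norm_phase (x : ℝ) (k : ℕ) (z : ℂ) :
    ‖phase x k z‖ = Real.exp (-(2 * Real.pi * x * (z.re * z.im)) + 2 * Real.pi * k * z.im) := by
  rw [phase, norm_exp]
  congr 1
  simp [sq]
  ring

theorem norm_phase_line (x a u : ℝ) (k : ℕ) :
    ‖phase x k ((a : ℂ) + ρ * u)‖
      = Real.exp (-(Real.pi * x * u ^ 2) - Real.sqrt 2 * Real.pi * u * (x * a - k)) := by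
  rw [norm_phase, line_re, line_im]
  congr 1
  linear_combination (-(Real.pi * x * u ^ 2) / 2) * sqrt_two_mul_self

theorem mul_le_half_sq_add {a : ℝ} (ha : 0 < a) (B v : ℝ) :
    B * v ≤ a / 2 * v ^ 2 + B ^ 2 / (2 * a) := by
  have : a / 2 * v ^ 2 + B ^ 2 / (2 * a) - B * v = (a * v - B) ^ 2 / (2 * a) := by
    field_simp; ring
  have h2 : 0 ≤ (a * v - B) ^ 2 / (2 * a) := by positivity
  linarith

theorem norm_phase_strip_le {x : ℝ} (hx : 0 < x) (k : ℕ) {A : ℝ} {z : ℂ}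
    (hz : |z.re - z.im| ≤ A) :
    ‖phase x k z‖ ≤ Real.exp ((2 * Real.pi * x * A + 2 * Real.pi * k + 1) ^ 2
      / (2 * (2 * Real.pi * x))) * Real.exp (-|z.im|) := by
  have hpi := Real.pi_pos
  rw [norm_phase, ← Real.exp_add]
  refine Real.exp_le_exp.2 ?_
  have h := mul_le_half_sq_add (by positivity : 0 < 2 * Real.pi * x)
    (2 * Real.pi * x * A + 2 * Real.pi * k + 1) |z.im|
  rw [sq_abs] at h
  have h1 : -(2 * Real.pi * x * ((z.re - z.im) * z.im)) ≤ 2 * Real.pi * x * (A * |z.im|) := by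
    rw [← mul_neg]
    refine mul_le_mul_of_nonneg_left ?_ (by positivity)
    refine (neg_le_abs _).trans ?_
    rw [abs_mul]
    gcongr
  have h2 : 2 * Real.pi * k * z.im ≤ 2 * Real.pi * k * |z.im| := by
    gcongr; exact le_abs_self _
  have h3 : 0 ≤ 2 * Real.pi * x * z.im ^ 2 := by positivity
  nlinarith

theorem norm_phase_line_le {x : ℝ} (hx : 0 < x) (a : ℝ) (k : ℕ) (u : ℝ) :
    ‖phase x k ((a : ℂ) + ρ * u)‖ ≤ Real.exp ((Real.sqrt 2 * Real.pi * (x * a - k)) ^ 2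
      / (2 * (Real.pi * x))) * Real.exp (-(Real.pi * x / 2) * u ^ 2) := by
  have hpi := Real.pi_pos
  rw [norm_phase_line, ← Real.exp_add]
  refine Real.exp_le_exp.2 ?_
  have h := mul_le_half_sq_add (by positivity : 0 < Real.pi * x)
    (Real.sqrt 2 * Real.pi * (x * a - k)) (-u)
  nlinarith

theorem half_le_norm (z : ℂ) : (z.re - z.im) / 2 ≤ ‖z‖ := by
  have h1 := (le_abs_self _).trans (abs_re_le_norm z)
  have h2 := (neg_le_abs _).trans (abs_im_le_norm z)
  linarith

theorem line_sub (a u : ℝ) : ((a : ℂ) + ρ * u).re - ((a : ℂ) + ρ * u).im = a := by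
  rw [line_re, line_im]; ring

theorem half_le_norm_line (a u : ℝ) : a / 2 ≤ ‖(a : ℂ) + ρ * u‖ := by
  have := half_le_norm ((a : ℂ) + ρ * u)
  rwa [line_sub] at this

theorem ne_zero_of_sub_pos {z : ℂ} (h : 0 < z.re - z.im) : z ≠ 0 := by
  rintro rfl; simp at h

theorem half_le_norm_one_sub_exp {z : ℂ} (hz : 1 ≤ |z.im|) :
    1 / 2 ≤ ‖1 - exp (2 * Real.pi * I * z)‖ := by
  have hn : ‖exp (2 * Real.pi * I * z)‖ = Real.exp (-(2 * Real.pi * z.im)) := by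
    rw [norm_exp]; simp
  have hpi := Real.pi_gt_three
  rcases le_abs.1 hz with h | h
  · have h1 := norm_sub_norm_le (1 : ℂ) (exp (2 * Real.pi * I * z))
    rw [norm_one, hn] at h1
    have h2 : Real.exp (-(2 * Real.pi * z.im)) ≤ 1 / 2 := by
      rw [Real.exp_neg]
      have := Real.add_one_le_exp (2 * Real.pi * z.im)
      rw [inv_le_comm₀ (Real.exp_pos _) (by norm_num)]
      nlinarith
    linarith
  · have h1 := norm_sub_norm_le (exp (2 * Real.pi * I * z)) 1
    rw [norm_one, hn, norm_sub_rev] at h1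
    have := Real.add_one_le_exp (-(2 * Real.pi * z.im))
    nlinarith

theorem max_le_norm_one_sub_exp (n : ℕ) (u : ℝ) :
    max 1 (Real.exp (-(Real.sqrt 2 * Real.pi * u))) / 2
      ≤ ‖1 - exp (2 * Real.pi * I * (((n + 1 / 2 : ℝ) : ℂ) + ρ * u))‖ := by
  set v := Real.sqrt 2 * Real.pi * u with hv
  have hpi := Real.pi_gt_three
  have e : exp (2 * Real.pi * I * (((n + 1 / 2 : ℝ) : ℂ) + ρ * u))
      = - exp (((-v : ℝ) : ℂ) + (v : ℂ) * I) := by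
    have : (2 * Real.pi * I * (((n + 1 / 2 : ℝ) : ℂ) + ρ * u) : ℂ)
        = (n : ℂ) * (2 * Real.pi * I) + Real.pi * I + (((-v : ℝ) : ℂ) + (v : ℂ) * I) := by
      rw [hv, rho_eq]
      push_cast
      linear_combination Real.pi * u * Real.sqrt 2 * I_sq
    rw [this, exp_add, exp_add, exp_nat_mul_two_pi_mul_I, exp_pi_mul_I]
    ring
  rw [e, sub_neg_eq_add]
  set q := exp (((-v : ℝ) : ℂ) + (v : ℂ) * I) with hq
  have hn : ‖q‖ = Real.exp (-v) := by rw [hq, norm_exp]; simp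
  have hre : q.re = Real.exp (-v) * Real.cos v := by rw [hq, exp_re]; simp
  rw [← hn]
  by_cases h : |v| ≤ Real.pi / 2
  · have hc : 0 ≤ Real.cos v := Real.cos_nonneg_of_mem_Icc (abs_le.1 h)
    have hre0 : 0 ≤ q.re := by rw [hre]; positivity
    have hsq : ‖1 + q‖ ^ 2 = 1 + 2 * q.re + ‖q‖ ^ 2 := by
      rw [Complex.sq_norm, Complex.sq_norm, normSq_apply, normSq_apply]
      simp; ring
    have h1 : 1 ≤ ‖1 + q‖ := by
      nlinarith [norm_nonneg (1 + q), sq_nonneg ‖q‖]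
    have h2 : ‖q‖ ≤ ‖1 + q‖ := by
      nlinarith [norm_nonneg (1 + q), norm_nonneg q]
    have := max_le h1 h2
    have h0 : 0 ≤ ‖1 + q‖ := norm_nonneg _
    linarith
  · rcases lt_abs.1 (not_le.1 h) with h | h
    · have h1 := norm_sub_norm_le (1 : ℂ) (-q)
      rw [norm_one, norm_neg, sub_neg_eq_add] at h1
      have h2 : ‖q‖ ≤ 1 / 2 := by
        rw [hn, Real.exp_neg]
        have := Real.add_one_le_exp v
        rw [inv_le_comm₀ (Real.exp_pos _) (by norm_num)]
        linarith
      rw [max_eq_left (by linarith)]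
      linarith
    · have h1 := norm_sub_norm_le q (-1)
      rw [norm_neg, norm_one, sub_neg_eq_add, add_comm q] at h1
      have h2 : 2 ≤ ‖q‖ := by
        rw [hn]
        have := Real.add_one_le_exp (-v)
        linarith
      rw [max_eq_right (by linarith)]
      linarith

theorem integrable_of_norm_le_gaussian {h : ℝ → ℂ} (hc : Continuous h) {K b : ℝ} (hb : 0 < b)
    (hh : ∀ u, ‖h u‖ ≤ K * Real.exp (-b * u ^ 2)) : Integrable h :=
  ((integrable_exp_neg_mul_sq hb).const_mul K).mono' hc.aestronglyMeasurable
    (Eventually.of_forall hh)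

/-- The integrand `e^{iπz²x - 2πikz} / z`. -/
noncomputable def phaseDiv (x : ℝ) (k : ℕ) (z : ℂ) : ℂ := phase x k z / z

/-- The integrand `e^{iπz²x - 2πimz} / (z (1 - e^{2πiz}))`. -/
noncomputable def kernelFn (x : ℝ) (m : ℕ) (z : ℂ) : ℂ :=
  phase x m z / (z * (1 - exp (2 * Real.pi * I * z)))

theorem phaseDiv_norm_line_le {x a : ℝ} (hx : 0 < x) (ha : 0 < a) (k : ℕ) (u : ℝ) :
    ‖phaseDiv x k ((a : ℂ) + ρ * u)‖ ≤ Real.exp ((Real.sqrt 2 * Real.pi * (x * a - k)) ^ 2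
      / (2 * (Real.pi * x))) / (a / 2) * Real.exp (-(Real.pi * x / 2) * u ^ 2) := by
  rw [phaseDiv, norm_div, div_mul_eq_mul_div]
  gcongr
  · exact norm_phase_line_le hx a k u
  · exact half_le_norm_line a u

theorem integrable_phaseDiv {x a : ℝ} (hx : 0 < x) (ha : 0 < a) (k : ℕ) :
    Integrable fun u : ℝ => phaseDiv x k ((a : ℂ) + ρ * u) := by
  refine integrable_of_norm_le_gaussian ?_ (by positivity : 0 < Real.pi * x / 2)
    (phaseDiv_norm_line_le hx ha k)
  unfold phaseDiv
  refine Continuous.div ((phase_differentiable x k).continuous.comp (by fun_prop)) (by fun_prop)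
    fun u => ne_zero_of_sub_pos ?_
  rw [line_sub]; exact ha

theorem integrable_kernelFn {x : ℝ} (hx : 0 < x) (m n : ℕ) :
    Integrable fun u : ℝ => kernelFn x m (((n + 1 / 2 : ℝ) : ℂ) + ρ * u) := by
  have ha : (0 : ℝ) < n + 1 / 2 := by positivity
  have hlow : ∀ u : ℝ, 1 / 2 ≤ ‖1 - exp (2 * Real.pi * I * (((n + 1 / 2 : ℝ) : ℂ) + ρ * u))‖ :=
    fun u => le_trans (by gcongr; exact le_max_left _ _) (max_le_norm_one_sub_exp n u)
  have hd : ∀ u : ℝ, 1 - exp (2 * Real.pi * I * (((n + 1 / 2 : ℝ) : ℂ) + ρ * u)) ≠ 0 := by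
    intro u h0
    have := hlow u
    rw [h0, norm_zero] at this; linarith
  have hq : ∀ z, kernelFn x m z = phaseDiv x m z / (1 - exp (2 * Real.pi * I * z)) := by
    intro z; rw [kernelFn, phaseDiv, div_div]
  simp_rw [hq]
  have hb : ∀ u : ℝ, ‖(1 - exp (2 * Real.pi * I * (((n + 1 / 2 : ℝ) : ℂ) + ρ * u)))⁻¹‖ ≤ 2 := by
    intro u
    rw [norm_inv]
    exact (inv_anti₀ (by norm_num) (hlow u)).trans (by norm_num)
  simp_rw [div_eq_mul_inv]
  refine (integrable_phaseDiv hx ha m).mul_bdd ?_ (Eventually.of_forall hb)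
  exact (Continuous.inv₀ (by fun_prop) hd).aestronglyMeasurable

theorem one_sub_exp_eq_zero_iff {z : ℂ} :
    1 - exp (2 * Real.pi * I * z) = 0 ↔ ∃ n : ℤ, z = n := by
  rw [sub_eq_zero, eq_comm, exp_eq_one_iff]
  have h : (2 * Real.pi * I : ℂ) ≠ 0 := two_pi_I_ne_zero
  refine exists_congr fun n => ?_
  rw [mul_comm (n : ℂ), mul_right_inj' h]

theorem kernelFn_residue {x : ℝ} (hx : 0 < x) {k : ℕ} (hk : 1 ≤ k) :
    ρ * (∫ u : ℝ, kernelFn x 0 (((k + 1 / 2 : ℝ) : ℂ) + ρ * u))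
      - ρ * ∫ u : ℝ, kernelFn x 0 (((k - 1 / 2 : ℝ) : ℂ) + ρ * u)
      = - (exp (Real.pi * I * k ^ 2 * x) / k) := by
  set E : ℂ → ℂ := fun z => 1 - exp (2 * Real.pi * I * z) with hE
  have hEd : Differentiable ℂ E := by rw [hE]; fun_prop
  have hEk : E k = 0 := one_sub_exp_eq_zero_iff.2 ⟨k, by simp⟩
  have hk1 : (1 : ℝ) ≤ k := by exact_mod_cast hk
  have hDd : Differentiable ℂ (dslope E k) := by
    have := (Complex.differentiableOn_dslope (f := E) (c := (k : ℂ)) (s := Set.univ) univ_mem).2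
      hEd.differentiableOn
    exact differentiableOn_univ.1 this
  have hDk : dslope E k k = - (2 * Real.pi * I) := by
    rw [dslope_same]
    have h1 : HasDerivAt (fun z : ℂ => 2 * Real.pi * I * z) (2 * Real.pi * I) (k : ℂ) := by
      simpa using (hasDerivAt_id (k : ℂ)).const_mul (2 * Real.pi * I : ℂ)
    have h2 := (h1.cexp.const_sub 1).deriv
    rw [hE, h2]
    have : exp (2 * Real.pi * I * (k : ℂ)) = 1 := by
      rw [mul_comm]; exact exp_nat_mul_two_pi_mul_I k
    rw [this, one_mul]
  have hDne : ∀ z : ℂ, z ≠ k → dslope E k z = E z / (z - k) := by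
    intro z hz
    rw [dslope_of_ne _ hz, slope_def_field, hEk, sub_zero]
  have hD0 : ∀ z : ℂ, |z.re - z.im - k| ≤ 1 / 2 → dslope E k z ≠ 0 := by
    intro z hz
    by_cases h : z = k
    · rw [h, hDk]; exact neg_ne_zero.2 two_pi_I_ne_zero
    · rw [hDne z h]
      refine div_ne_zero ?_ (sub_ne_zero.2 h)
      intro h0
      obtain ⟨n, rfl⟩ := one_sub_exp_eq_zero_iff.1 h0
      apply h
      simp only [intCast_re, intCast_im, sub_zero] at hz
      have : |n - (k : ℤ)| < 1 := by
        have : |(n : ℝ) - k| < 1 := by linarith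
        exact_mod_cast this
      have := Int.abs_lt_one_iff.1 this
      have : n = k := by linarith
      rw [this]; simp
  have hpos : ∀ z : ℂ, |z.re - z.im - k| ≤ 1 / 2 →
      1 / 2 ≤ z.re - z.im ∧ z.re - z.im ≤ k + 1 / 2 := by
    intro z hz
    have := abs_le.1 hz
    constructor <;> linarith [this.1, this.2]
  have hz0 : ∀ z : ℂ, |z.re - z.im - k| ≤ 1 / 2 → z ≠ 0 := fun z hz =>
    ne_zero_of_sub_pos (by linarith [(hpos z hz).1])
  have hi1 : Integrable fun u : ℝ => kernelFn x 0 (((k - 1 / 2 : ℝ) : ℂ) + ρ * u) := by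
    have := integrable_kernelFn hx 0 (k - 1)
    have e : (((k - 1 : ℕ) : ℝ) + 1 / 2) = k - 1 / 2 := by
      rw [Nat.cast_sub hk]; push_cast; ring
    rwa [e] at this
  have := integral_slanted_residue (a := k) (d := 1 / 2) (by norm_num)
    (φ := fun z => phase x 0 z / (z * dslope E k z)) (f := kernelFn x 0)
    (fun z hz => ((phase_differentiable x 0) z).div (differentiableAt_id.mul (hDd z))
      (mul_ne_zero (hz0 z hz) (hD0 z hz)))
    (fun z hz hne => by
      rw [ofReal_natCast] at hne ⊢
      rw [kernelFn, hDne z hne]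
      have h1 := sub_ne_zero.2 hne
      have h2 := hD0 z hz
      rw [hDne z hne] at h2
      have h3 : E z ≠ 0 := fun h => h2 (by rw [h, zero_div])
      have h4 := hz0 z hz
      have h5 : 1 - exp (2 * Real.pi * I * z) = E z := rfl
      rw [h5]
      field_simp)
    (K := Real.exp ((2 * Real.pi * x * (k + 1 / 2) + 2 * Real.pi * (0 : ℕ) + 1) ^ 2
      / (2 * (2 * Real.pi * x))) / (1 / 4 * (1 / 2)))
    (fun z hz him => by
      obtain ⟨h1, h2⟩ := hpos z hz
      rw [kernelFn, norm_div, norm_mul, div_mul_eq_mul_div]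
      gcongr
      · exact norm_phase_strip_le hx 0 (abs_le.2 ⟨by linarith, h2⟩)
      · linarith [half_le_norm z]
      · exact half_le_norm_one_sub_exp him)
    hi1 (integrable_kernelFn hx 0 k)
  rw [this, ofReal_natCast, hDk, phase]
  have hk0 : (k : ℂ) ≠ 0 := by exact_mod_cast (by omega : k ≠ 0)
  have hpi := two_pi_I_ne_zero
  simp only [Nat.cast_zero, mul_zero, zero_mul, sub_zero]
  field_simp

theorem Fpart_one (n : ℕ) (x : ℝ) :
    Fpart 1 n x 0 = ∑ k ∈ Finset.Icc 1 n, exp (Real.pi * I * k ^ 2 * x) / k := by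
  simp [Fpart]

theorem Fpart_eq_kernelFn {x : ℝ} (hx : 0 < x) (n : ℕ) :
    Fpart 1 n x 0 = ρ * (∫ u : ℝ, kernelFn x 0 (((1 / 2 : ℝ) : ℂ) + ρ * u))
      - ρ * ∫ u : ℝ, kernelFn x 0 (((n + 1 / 2 : ℝ) : ℂ) + ρ * u) := by
  rw [Fpart_one]
  induction n with
  | zero => simp
  | succ n ih =>
    have h := kernelFn_residue hx (k := n + 1) (by omega)
    have e : (((n + 1 : ℕ) : ℝ) - 1 / 2) = n + 1 / 2 := by push_cast; ring
    rw [e] at h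
    rw [Finset.sum_Icc_succ_top (by omega), ih]
    linear_combination h

theorem kernelFn_eq_sum (x : ℝ) (m : ℕ) {z : ℂ} (hz : z ≠ 0)
    (hE : 1 - exp (2 * Real.pi * I * z) ≠ 0) :
    kernelFn x 0 z = kernelFn x m z - ∑ k ∈ Finset.Icc 1 m, phaseDiv x k z := by
  induction m with
  | zero => simp
  | succ m ih =>
    rw [Finset.sum_Icc_succ_top (by omega), ih]
    have key : phase x m z = phase x (m + 1) z * exp (2 * Real.pi * I * z) := by
      rw [phase, phase, ← exp_add]; congr 1; push_cast; ring
    simp only [kernelFn, phaseDiv, key]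
    field_simp
    ring

theorem integral_kernelFn_eq {x : ℝ} (hx : 0 < x) (m n : ℕ) :
    ∫ u : ℝ, kernelFn x 0 (((n + 1 / 2 : ℝ) : ℂ) + ρ * u)
      = (∫ u : ℝ, kernelFn x m (((n + 1 / 2 : ℝ) : ℂ) + ρ * u))
        - ∑ k ∈ Finset.Icc 1 m, ∫ u : ℝ, phaseDiv x k (((n + 1 / 2 : ℝ) : ℂ) + ρ * u) := by
  have ha : (0 : ℝ) < n + 1 / 2 := by positivity
  rw [← integral_finsetSum _ fun k _ => integrable_phaseDiv hx ha k,
    ← integral_sub (integrable_kernelFn hx m n)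
      (integrable_finsetSum _ fun k _ => integrable_phaseDiv hx ha k)]
  refine integral_congr_ae (Eventually.of_forall fun u => ?_)
  refine kernelFn_eq_sum x m (ne_zero_of_sub_pos (by rw [line_sub]; exact ha)) ?_
  intro h0
  have := max_le_norm_one_sub_exp n u
  rw [h0, norm_zero] at this
  linarith [le_max_left 1 (Real.exp (-(Real.sqrt 2 * Real.pi * u)))]

theorem integral_phaseDiv_eq {x a : ℝ} (hx : 0 < x) {k : ℕ} (hk : 1 ≤ k) (hka : k ≤ a * x) :
    ∫ u : ℝ, phaseDiv x k ((a : ℂ) + ρ * u)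
      = x * exp (-(Real.pi * I * k ^ 2 / x)) *
        ∫ u : ℝ, (Real.exp (-(Real.pi * x * u ^ 2)) : ℝ) * (ρ * x * u + k)⁻¹ := by
  have hk1 : (1 : ℝ) ≤ k := by exact_mod_cast hk
  have hb0 : 0 < k / x := by positivity
  have hba : k / x ≤ a := (div_le_iff₀ hx).2 hka
  have ha0 : 0 < a := hb0.trans_le hba
  have hxc : (x : ℂ) ≠ 0 := by exact_mod_cast hx.ne'
  rw [← integral_slanted_eq hba (f := phaseDiv x k)
    (fun z h1 h2 => ((phase_differentiable x k) z).div differentiableAt_id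
      (ne_zero_of_sub_pos (hb0.trans_le h1)))
    (K := Real.exp ((2 * Real.pi * x * a + 2 * Real.pi * k + 1) ^ 2
      / (2 * (2 * Real.pi * x))) / (k / x / 2))
    (fun z h1 h2 _ => by
      rw [phaseDiv, norm_div, div_mul_eq_mul_div]
      gcongr
      · exact norm_phase_strip_le hx k (abs_le.2 ⟨by linarith, h2⟩)
      · linarith [half_le_norm z])
    (integrable_phaseDiv hx hb0 k) (integrable_phaseDiv hx ha0 k), ← integral_const_mul]
  refine integral_congr_ae (Eventually.of_forall fun u => ?_)
  have h1 : phase x k (((k / x : ℝ) : ℂ) + ρ * u)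
      = exp (-(Real.pi * I * k ^ 2 / x)) * (Real.exp (-(Real.pi * x * u ^ 2)) : ℝ) := by
    rw [phase, ofReal_exp, ← exp_add]
    congr 1
    push_cast
    field_simp
    linear_combination I * x ^ 2 * u ^ 2 * rho_sq + x ^ 2 * u ^ 2 * I_sq
  have h2 : ((k / x : ℝ) : ℂ) + ρ * u = (ρ * x * u + k) / x := by
    push_cast; field_simp; ring
  simp only [phaseDiv]
  rw [h1, h2]
  have h3 : (ρ * x * u + k : ℂ) ≠ 0 := by
    refine ne_zero_of_sub_pos ?_
    have := line_sub k (x * u)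
    push_cast at this
    have e : (ρ * x * u + k : ℂ) = k + ρ * (x * u) := by ring
    rw [e, this]; linarith
  field_simp

/-- The `k`-th summand of the second integrand of `Ifun 1 x 0`, with its Gaussian weight. -/
noncomputable def corrFn (x : ℝ) (k : ℕ) (u : ℝ) : ℂ :=
  (Real.exp (-(Real.pi * x * u ^ 2)) : ℝ) *
    (exp (-(Real.pi * I * ((k : ℂ) + 1) ^ 2 / x)) *
      ((ρ * x * u + ((k : ℂ) + 1))⁻¹ - ((k : ℂ) + 1)⁻¹))

theorem half_le_norm_shift (x u : ℝ) (k : ℕ) :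
    ((k : ℝ) + 1) / 2 ≤ ‖ρ * x * u + ((k : ℂ) + 1)‖ := by
  have := half_le_norm_line (k + 1) (x * u)
  have e : (ρ * x * u + ((k : ℂ) + 1)) = ((k + 1 : ℝ) : ℂ) + ρ * ((x * u : ℝ) : ℂ) := by
    push_cast; ring
  rwa [e]

theorem shift_ne_zero (x u : ℝ) (k : ℕ) : ρ * x * u + ((k : ℂ) + 1) ≠ 0 := by
  intro h
  have h1 := half_le_norm_shift x u k
  rw [h, norm_zero] at h1
  have : (0 : ℝ) ≤ k := k.cast_nonneg
  linarith

theorem abs_mul_exp_le {x : ℝ} (hx : 0 < x) (u : ℝ) :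
    Real.sqrt x * |u| * Real.exp (-(Real.pi * x * u ^ 2)) ≤ Real.exp (-x * u ^ 2) := by
  have hpi := Real.pi_gt_three
  set v := Real.sqrt x * |u| with hv
  have hv0 : 0 ≤ v := by positivity
  have hv2 : x * u ^ 2 = v ^ 2 := by rw [hv, mul_pow, Real.sq_sqrt hx.le, sq_abs]
  have e1 : -(Real.pi * x * u ^ 2) = -(Real.pi * v ^ 2) := by rw [← hv2]; ring
  rw [e1, neg_mul, hv2]
  have h1 : v ≤ Real.exp (v ^ 2) :=
    le_trans (by nlinarith [sq_nonneg (v - 1)]) (Real.add_one_le_exp (v ^ 2))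
  calc v * Real.exp (-(Real.pi * v ^ 2)) ≤ Real.exp (v ^ 2) * Real.exp (-(Real.pi * v ^ 2)) := by
        gcongr
    _ = Real.exp (v ^ 2 + -(Real.pi * v ^ 2)) := (Real.exp_add _ _).symm
    _ ≤ _ := Real.exp_le_exp.2 (by nlinarith [sq_nonneg v])

theorem norm_exp_I_mul_real (y : ℝ) {z : ℂ} (h : z = y * I) : ‖exp z‖ = 1 := by
  rw [h, norm_exp_ofReal_mul_I]

theorem norm_corrFn_le {x : ℝ} (hx : 0 < x) (k : ℕ) (u : ℝ) :
    ‖corrFn x k u‖ ≤ 2 * Real.sqrt x / ((k : ℝ) + 1) ^ 2 * Real.exp (-x * u ^ 2) := by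
  have hk0 : (0 : ℝ) < k + 1 := by positivity
  have hkc : ((k : ℂ) + 1) ≠ 0 := by exact_mod_cast hk0.ne'
  have hkn : ‖(k : ℂ) + 1‖ = k + 1 := by
    rw [← abs_of_pos hk0, ← Real.norm_eq_abs, ← norm_real]; push_cast; rfl
  have h1 : ‖exp (-(Real.pi * I * ((k : ℂ) + 1) ^ 2 / x))‖ = 1 :=
    norm_exp_I_mul_real (-(Real.pi * (k + 1) ^ 2 / x)) (by push_cast; ring)
  have h2 : ‖(ρ * x * u + ((k : ℂ) + 1))⁻¹ - ((k : ℂ) + 1)⁻¹‖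
      ≤ x * |u| / (((k : ℝ) + 1) / 2 * (k + 1)) := by
    rw [inv_sub_inv (shift_ne_zero x u k) hkc, norm_div, norm_mul, hkn]
    have : ‖(k : ℂ) + 1 - (ρ * x * u + ((k : ℂ) + 1))‖ = x * |u| := by
      have e : (k : ℂ) + 1 - (ρ * x * u + ((k : ℂ) + 1)) = -(ρ * x * u) := by ring
      rw [e, norm_neg, norm_mul, norm_mul, norm_rho, norm_real, norm_real, Real.norm_eq_abs,
        Real.norm_eq_abs, abs_of_pos hx, one_mul]
    rw [this]
    gcongr
    exact half_le_norm_shift x u k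
  rw [corrFn, norm_mul, norm_mul, h1, one_mul, norm_real, Real.norm_eq_abs, Real.abs_exp]
  have hsx : Real.sqrt x * Real.sqrt x = x := Real.mul_self_sqrt hx.le
  calc _ ≤ Real.exp (-(Real.pi * x * u ^ 2)) * (x * |u| / (((k : ℝ) + 1) / 2 * (k + 1))) := by
        gcongr
    _ = 2 * Real.sqrt x / ((k : ℝ) + 1) ^ 2
          * (Real.sqrt x * |u| * Real.exp (-(Real.pi * x * u ^ 2))) := by
        nth_rewrite 2 [← hsx]
        field_simp
    _ ≤ _ := by
        gcongr
        exact abs_mul_exp_le hx u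

theorem continuous_corrFn (x : ℝ) (k : ℕ) : Continuous (corrFn x k) := by
  unfold corrFn
  have : Continuous fun u : ℝ => (ρ * x * u + ((k : ℂ) + 1))⁻¹ :=
    Continuous.inv₀ (by fun_prop) fun u => shift_ne_zero x u k
  fun_prop

theorem integrable_corrFn {x : ℝ} (hx : 0 < x) (k : ℕ) : Integrable (corrFn x k) :=
  integrable_of_norm_le_gaussian (continuous_corrFn x k) hx (norm_corrFn_le hx k)

theorem integral_norm_corrFn_le {x : ℝ} (hx : 0 < x) (k : ℕ) :
    ∫ u, ‖corrFn x k u‖ ≤ 4 / ((k : ℝ) + 1) ^ 2 := by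
  have hpi := Real.pi_pos
  have h := integral_mono (integrable_corrFn hx k).norm
    ((integrable_exp_neg_mul_sq hx).const_mul (2 * Real.sqrt x / ((k : ℝ) + 1) ^ 2))
    (norm_corrFn_le hx k)
  rw [integral_const_mul, integral_gaussian] at h
  refine h.trans ?_
  have e : Real.sqrt x * Real.sqrt (Real.pi / x) = Real.sqrt Real.pi := by
    rw [← Real.sqrt_mul hx.le]; congr 1; field_simp
  have e2 : Real.sqrt Real.pi ≤ 2 := by
    rw [Real.sqrt_le_left (by norm_num)]; linarith [Real.pi_lt_four]
  calc _ = 2 * (Real.sqrt x * Real.sqrt (Real.pi / x)) / ((k : ℝ) + 1) ^ 2 := by ring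
    _ ≤ _ := by rw [e]; gcongr; linarith

theorem norm_integral_corrFn_le {x : ℝ} (hx : 0 < x) (k : ℕ) :
    ‖∫ u, corrFn x k u‖ ≤ 4 / ((k : ℝ) + 1) ^ 2 :=
  (norm_integral_le_integral_norm _).trans (integral_norm_corrFn_le hx k)

theorem sum_tail_sq_le (m N : ℕ) :
    ∑ k ∈ Finset.range N, 4 / (((k + m : ℕ) : ℝ) + 1) ^ 2 ≤ 8 / ((m : ℝ) + 1) := by
  have h : ∑ k ∈ Finset.range N, 4 / (((k + m : ℕ) : ℝ) + 1) ^ 2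
      ≤ 8 / ((m : ℝ) + 1) - 8 / ((N + m : ℕ) + 1) := by
    induction N with
    | zero => simp
    | succ N ih =>
      rw [Finset.sum_range_succ]
      have : (4 : ℝ) / (((N + m : ℕ) : ℝ) + 1) ^ 2
          ≤ 8 / ((N + m : ℕ) + 1) - 8 / ((N + 1 + m : ℕ) + 1) := by
        have e : ((N + 1 + m : ℕ) : ℝ) = (N + m : ℕ) + 1 := by push_cast; ring
        rw [e]
        have h0 : (0 : ℝ) ≤ (N + m : ℕ) := Nat.cast_nonneg _
        generalize ((N + m : ℕ) : ℝ) = t at h0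
        rw [div_sub_div _ _ (by positivity) (by positivity),
          div_le_div_iff₀ (by positivity) (by positivity)]
        nlinarith [mul_nonneg h0 h0, mul_nonneg h0 (mul_nonneg h0 h0)]
      linarith
  have : (0 : ℝ) ≤ 8 / ((N + m : ℕ) + 1) := by positivity
  linarith

theorem summable_corr_bound : Summable fun k : ℕ => 4 / ((k : ℝ) + 1) ^ 2 :=
  summable_of_sum_range_le (fun _ => by positivity) fun N => by
    simpa using sum_tail_sq_le 0 N

theorem summable_integral_corrFn {x : ℝ} (hx : 0 < x) : Summable fun k => ∫ u, corrFn x k u :=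
  Summable.of_norm_bounded summable_corr_bound (norm_integral_corrFn_le hx)

theorem norm_tsum_tail_le {x : ℝ} (hx : 0 < x) (m : ℕ) :
    ‖∑' k, ∫ u, corrFn x (k + m) u‖ ≤ 8 / ((m : ℝ) + 1) := by
  have hs : Summable fun k : ℕ => 4 / (((k + m : ℕ) : ℝ) + 1) ^ 2 :=
    (summable_nat_add_iff (f := fun k : ℕ => 4 / ((k : ℝ) + 1) ^ 2) m).2 summable_corr_bound
  exact (tsum_of_norm_bounded hs.hasSum fun k => norm_integral_corrFn_le hx (k + m)).trans
    (Real.tsum_le_of_sum_range_le (fun _ => by positivity) (sum_tail_sq_le m))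

theorem Ifun_one {x : ℝ} (hx : 0 < x) :
    Ifun 1 x 0 = ρ * (∫ u : ℝ, kernelFn x 0 (((1 / 2 : ℝ) : ℂ) + ρ * u))
      + ρ * x * ∑' k, ∫ u, corrFn x k u := by
  have hS : Summable fun k => ∫ u, ‖corrFn x k u‖ :=
    Summable.of_nonneg_of_le (fun k => integral_nonneg fun u => norm_nonneg _)
      (integral_norm_corrFn_le hx) summable_corr_bound
  rw [integral_tsum_of_summable_integral_norm (fun k => integrable_corrFn hx k) hS,
    ← integral_const_mul]
  simp only [Ifun, kernelFn, phase, corrFn, tsum_mul_left]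
  simp

theorem integral_corrFn_eq {x : ℝ} (hx : 0 < x) (k : ℕ) :
    ρ * (x * exp (-(Real.pi * I * ((k : ℂ) + 1) ^ 2 / x)) *
        ∫ u : ℝ, (Real.exp (-(Real.pi * x * u ^ 2)) : ℝ) * (ρ * x * u + ((k : ℂ) + 1))⁻¹)
      = ρ * x * (∫ u, corrFn x k u)
        + ρ * (Real.sqrt x : ℝ) * (exp (-(Real.pi * I * ((k : ℂ) + 1) ^ 2 / x)) / (k + 1)) := by
  set e := exp (-(Real.pi * I * ((k : ℂ) + 1) ^ 2 / x)) with he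
  have hg : Integrable fun u : ℝ => ((Real.exp (-(Real.pi * x * u ^ 2)) : ℝ) : ℂ) := by
    have := integrable_exp_neg_mul_sq (by positivity : 0 < Real.pi * x)
    simp only [neg_mul] at this
    exact this.ofReal (𝕜 := ℂ)
  have hgv : ∫ u : ℝ, ((Real.exp (-(Real.pi * x * u ^ 2)) : ℝ) : ℂ) = ((Real.sqrt x)⁻¹ : ℝ) := by
    rw [integral_complex_ofReal]
    have := integral_gaussian (Real.pi * x)
    simp only [neg_mul] at this
    rw [this, ← Real.sqrt_inv]
    congr 2
    have := Real.pi_pos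
    field_simp
  have h1 : ∀ u : ℝ, e * ((Real.exp (-(Real.pi * x * u ^ 2)) : ℝ) * (ρ * x * u + ((k : ℂ) + 1))⁻¹)
      = corrFn x k u + e / (k + 1) * (Real.exp (-(Real.pi * x * u ^ 2)) : ℝ) := by
    intro u; rw [corrFn, ← he]; ring
  have h2 : e * ∫ u : ℝ, (Real.exp (-(Real.pi * x * u ^ 2)) : ℝ) * (ρ * x * u + ((k : ℂ) + 1))⁻¹
      = (∫ u, corrFn x k u) + e / (k + 1) * ((Real.sqrt x)⁻¹ : ℝ) := by
    rw [← integral_const_mul]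
    simp_rw [h1]
    rw [integral_add (integrable_corrFn hx k) (hg.const_mul _), integral_const_mul, hgv]
  have h3 : (x : ℂ) * ((Real.sqrt x)⁻¹ : ℝ) = (Real.sqrt x : ℝ) := by
    rw [← ofReal_mul, ← div_eq_mul_inv, Real.div_sqrt]
  rw [mul_assoc (x : ℂ), h2]
  linear_combination ρ * e / (k + 1) * h3

theorem error_eq {x : ℝ} (hx : 0 < x) {m n : ℕ} (hmn : m ≤ n * x) :
    Fpart 1 n x 0 - ρ * (Real.sqrt x : ℝ) * Fpart 1 m (-1 / x) 0 - Ifun 1 x 0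
      = -(ρ * x * ∑' k, ∫ u, corrFn x (k + m) u)
        - ρ * ∫ u : ℝ, kernelFn x m (((n + 1 / 2 : ℝ) : ℂ) + ρ * u) := by
  have hsum : ρ * ∑ k ∈ Finset.Icc 1 m, ∫ u : ℝ, phaseDiv x k (((n + 1 / 2 : ℝ) : ℂ) + ρ * u)
      = ρ * x * (∑ k ∈ Finset.range m, ∫ u, corrFn x k u)
        + ρ * (Real.sqrt x : ℝ) * Fpart 1 m (-1 / x) 0 := by
    rw [Fpart_one, Finset.mul_sum, Finset.mul_sum, Finset.mul_sum,
      ← Finset.Ico_add_one_right_eq_Icc, Finset.sum_Ico_eq_sum_range, Finset.sum_Ico_eq_sum_range,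
      Nat.add_sub_cancel, ← Finset.sum_add_distrib]
    refine Finset.sum_congr rfl fun k hk => ?_
    have hk' : k + 1 ≤ m := by simpa using hk
    have hle : ((1 + k : ℕ) : ℝ) ≤ (n + 1 / 2) * x := by
      have : ((1 + k : ℕ) : ℝ) ≤ m := by exact_mod_cast (by omega)
      nlinarith
    rw [integral_phaseDiv_eq hx (by omega) hle]
    have := integral_corrFn_eq hx k
    push_cast at this ⊢
    rw [add_comm (1 : ℂ) k, this]
    congr 4
    ring
  rw [Fpart_eq_kernelFn hx, integral_kernelFn_eq hx m n, Ifun_one hx,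
    ← (summable_integral_corrFn hx).sum_add_tsum_nat_add m]
  linear_combination hsum

theorem norm_kernelFn_le {x : ℝ} (hx : 0 < x) {m n : ℕ} (h1 : m ≤ n * x)
    (h2 : n * x < m + 1) (u : ℝ) :
    ‖kernelFn x m (((n + 1 / 2 : ℝ) : ℂ) + ρ * u)‖
      ≤ 8 * Real.exp (Real.pi * x / 2) / (n + 1) * Real.exp (-(Real.pi * x / 2) * u ^ 2) := by
  have hpi := Real.pi_pos
  set v := Real.sqrt 2 * Real.pi * u with hv
  set θ := x * (n + 1 / 2) - m with hθ
  have hθ0 : 0 ≤ θ := by rw [hθ]; nlinarith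
  have hθ1 : θ ≤ 1 + x / 2 := by rw [hθ]; nlinarith
  have hnum : Real.exp (-(v * θ)) ≤
      Real.exp (x / 2 * |v|) * max 1 (Real.exp (-v)) := by
    rcases le_total 0 v with h | h
    · have a1 : Real.exp (-(v * θ)) ≤ 1 := Real.exp_le_one_iff.2 (by nlinarith)
      have a2 : 1 ≤ Real.exp (x / 2 * |v|) := Real.one_le_exp (by positivity)
      have a3 : (1 : ℝ) ≤ max 1 (Real.exp (-v)) := le_max_left _ _
      nlinarith
    · refine le_trans ?_ (mul_le_mul_of_nonneg_left (le_max_right _ _) (Real.exp_pos _).le)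
      rw [← Real.exp_add, abs_of_nonpos h]
      refine Real.exp_le_exp.2 ?_
      nlinarith
  have hv' : x / 2 * |v| ≤ Real.pi * x / 2 * u ^ 2 + Real.pi * x / 2 := by
    rw [hv, abs_mul, abs_of_pos (by positivity : 0 < Real.sqrt 2 * Real.pi)]
    have hs : Real.sqrt 2 ≤ 2 := by
      rw [Real.sqrt_le_left (by norm_num)]; norm_num
    have a1 : Real.sqrt 2 * |u| ≤ u ^ 2 + 1 := by
      rw [← sq_abs]
      nlinarith [sq_nonneg (|u| - 1), abs_nonneg u]
    have a2 := mul_le_mul_of_nonneg_left a1 (by positivity : 0 ≤ Real.pi * x / 2)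
    linarith
  have hden := max_le_norm_one_sub_exp n u
  rw [← hv] at hden
  have hz : ((n : ℝ) + 1) / 4 ≤ ‖((n + 1 / 2 : ℝ) : ℂ) + ρ * u‖ := by
    refine le_trans ?_ (half_le_norm_line (n + 1 / 2) u)
    have : (0 : ℝ) ≤ n := n.cast_nonneg
    linarith
  have hM : 0 < max 1 (Real.exp (-v)) := lt_max_of_lt_left one_pos
  rw [kernelFn, norm_div, norm_mul, norm_phase_line, ← hv, ← hθ, sub_eq_add_neg, Real.exp_add]
  calc _ ≤ Real.exp (-(Real.pi * x * u ^ 2)) * (Real.exp (x / 2 * |v|) * max 1 (Real.exp (-v)))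
        / (((n : ℝ) + 1) / 4 * (max 1 (Real.exp (-v)) / 2)) := by gcongr
    _ = 8 / (n + 1) * Real.exp (-(Real.pi * x * u ^ 2) + x / 2 * |v|) := by
        rw [Real.exp_add]; field_simp; ring
    _ ≤ 8 / (n + 1) * Real.exp (Real.pi * x / 2 + -(Real.pi * x / 2) * u ^ 2) := by
        refine mul_le_mul_of_nonneg_left (Real.exp_le_exp.2 ?_) (by positivity)
        linarith
    _ = _ := by rw [Real.exp_add]; ring

theorem norm_integral_kernelFn_le {x : ℝ} (hx : 0 < x) (hx1 : x ≤ 1) {m n : ℕ} (h1 : m ≤ n * x)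
    (h2 : n * x < m + 1) :
    ‖∫ u : ℝ, kernelFn x m (((n + 1 / 2 : ℝ) : ℂ) + ρ * u)‖
      ≤ 16 * Real.exp 2 / ((n + 1) * Real.sqrt x) := by
  have hpi := Real.pi_pos
  have hb : 0 < Real.pi * x / 2 := by positivity
  have h := norm_integral_le_of_norm_le
    ((integrable_exp_neg_mul_sq hb).const_mul (8 * Real.exp (Real.pi * x / 2) / ((n : ℝ) + 1)))
    (Eventually.of_forall (norm_kernelFn_le hx h1 h2))
  rw [integral_const_mul, integral_gaussian] at h
  refine h.trans ?_
  have e : Real.sqrt (Real.pi / (Real.pi * x / 2)) = Real.sqrt 2 / Real.sqrt x := by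
    rw [← Real.sqrt_div (by norm_num)]; congr 1; field_simp
  have hs : Real.sqrt 2 ≤ 2 := by
    rw [Real.sqrt_le_left (by norm_num)]; norm_num
  have he : Real.exp (Real.pi * x / 2) ≤ Real.exp 2 :=
    Real.exp_le_exp.2 (by nlinarith [Real.pi_lt_four])
  have hsx : 0 < Real.sqrt x := Real.sqrt_pos.2 hx
  rw [e]
  calc _ ≤ 8 * Real.exp 2 / ((n : ℝ) + 1) * (2 / Real.sqrt x) := by gcongr
    _ = _ := by field_simp; ring

/-- The error term of the approximate functional equation, for `x > 0`. -/
noncomputable def errorTerm (x : ℝ) (n : ℕ) : ℂ :=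
  Fpart 1 n x 0 - ρ * (Real.sqrt x : ℝ) * Fpart 1 ⌊(n : ℝ) * x⌋₊ (-1 / x) 0 - Ifun 1 x 0

theorem norm_errorTerm_le {x : ℝ} (hx : 0 < x) (hx1 : x ≤ 1) (n : ℕ) :
    ‖errorTerm x n‖ ≤ (16 + 16 * Real.exp 2) / ((n + 1) * Real.sqrt x) := by
  have hnx : 0 ≤ (n : ℝ) * x := by positivity
  have h1 := Nat.floor_le hnx
  have h2 := Nat.lt_floor_add_one ((n : ℝ) * x)
  set m := ⌊(n : ℝ) * x⌋₊ with hm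
  have hsx : 0 < Real.sqrt x := Real.sqrt_pos.2 hx
  have hsx1 : Real.sqrt x ≤ 1 := Real.sqrt_le_one.2 hx1
  have hm0 : (0 : ℝ) ≤ m := m.cast_nonneg
  have ht : ‖-(ρ * x * ∑' k, ∫ u, corrFn x (k + m) u)‖ ≤ 16 / ((n + 1) * Real.sqrt x) := by
    rw [norm_neg, norm_mul, norm_mul, norm_rho, one_mul, norm_real, Real.norm_eq_abs,
      abs_of_pos hx]
    calc x * ‖∑' k, ∫ u, corrFn x (k + m) u‖ ≤ x * (8 / ((m : ℝ) + 1)) := by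
          gcongr; exact norm_tsum_tail_le hx m
      _ ≤ 16 / (n + 1) := by
          rw [← mul_div_assoc, div_le_div_iff₀ (by positivity) (by positivity)]
          nlinarith
      _ ≤ _ := by
          gcongr
          exact mul_le_of_le_one_right (by positivity) hsx1
  have hr : ‖ρ * ∫ u : ℝ, kernelFn x m (((n + 1 / 2 : ℝ) : ℂ) + ρ * u)‖
      ≤ 16 * Real.exp 2 / ((n + 1) * Real.sqrt x) := by
    rw [norm_mul, norm_rho, one_mul]
    exact norm_integral_kernelFn_le hx hx1 h1 h2
  rw [errorTerm, ← hm, error_eq hx h1, add_div]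
  exact (norm_sub_le _ _).trans (add_le_add ht hr)

theorem sum_inv_le_log (n j : ℕ) :
    ∑ k ∈ Finset.Ioc n (n + 1 + j), (1 : ℝ) / k
      ≤ 1 + Real.log ((n + 1 + j : ℕ) : ℝ) - Real.log (n + 1) := by
  induction j with
  | zero =>
    have : Finset.Ioc n (n + 1 + 0) = {n + 1} := by ext; simp
    rw [this]
    have h0 : (0 : ℝ) < n + 1 := by positivity
    simp
    rw [inv_le_one₀ h0]
    have : (0 : ℝ) ≤ n := n.cast_nonneg
    linarith
  | succ j ih =>
    rw [← add_assoc, Finset.sum_Ioc_succ_top (by omega)]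
    have h0 : (0 : ℝ) < (n + 1 + j : ℕ) := by positivity
    have h1 : (1 : ℝ) / ((n + 1 + j + 1 : ℕ) : ℝ)
        ≤ Real.log ((n + 1 + j + 1 : ℕ) : ℝ) - Real.log ((n + 1 + j : ℕ) : ℝ) := by
      rw [Nat.cast_succ, ← Real.log_div (by positivity) h0.ne']
      refine le_trans (le_of_eq ?_) (Real.one_sub_inv_le_log_of_pos (by positivity))
      field_simp
      ring
    linarith

theorem norm_Fpart_sub_le (x : ℝ) (n j : ℕ) :
    ‖Fpart 1 (n + 1 + j) x 0 - Fpart 1 n x 0‖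
      ≤ 1 + Real.log ((n + 1 + j : ℕ) : ℝ) - Real.log (n + 1) := by
  refine le_trans ?_ (sum_inv_le_log n j)
  have : Fpart 1 (n + 1 + j) x 0 - Fpart 1 n x 0
      = ∑ k ∈ Finset.Ioc n (n + 1 + j), exp (Real.pi * I * k ^ 2 * x) / k := by
    rw [Fpart_one, Fpart_one, sub_eq_iff_eq_add', ← Finset.Ico_add_one_right_eq_Icc,
      ← Finset.Ico_add_one_right_eq_Icc, ← Finset.Ico_add_one_add_one_eq_Ioc,
      Finset.sum_Ico_consecutive _ (by omega) (by omega)]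
  rw [this]
  refine norm_sum_le_of_le _ fun k _ => ?_
  rw [norm_div, norm_exp_I_mul_real (Real.pi * k ^ 2 * x) (by push_cast; ring), norm_natCast]

theorem norm_errorTerm_le_min {x : ℝ} (hx : 0 < x) (hx1 : x ≤ 1) (n : ℕ) :
    ‖errorTerm x n‖ ≤ (17 + 16 * Real.exp 2) * min (1 / ((n + 1) * Real.sqrt x))
      (1 + |Real.log ((n + 1) * Real.sqrt x)|) := by
  have hsx : 0 < Real.sqrt x := Real.sqrt_pos.2 hx
  have hE := Real.exp_pos 2
  have hn1 : (0 : ℝ) < n + 1 := by positivity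
  have hy0 : 0 < (n + 1) * Real.sqrt x := by positivity
  rcases le_or_gt 1 (((n : ℝ) + 1) * Real.sqrt x) with hy | hy
  · rw [min_eq_left]
    · refine (norm_errorTerm_le hx hx1 n).trans ?_
      rw [← mul_one_div]
      gcongr
      norm_num
    · exact ((div_le_one hy0).2 hy).trans (le_add_of_nonneg_right (abs_nonneg _))
  · have hlog : Real.log ((n + 1) * Real.sqrt x) ≤ 0 := Real.log_nonpos hy0.le hy.le
    rw [min_eq_right]
    swap
    · rw [abs_of_nonpos hlog, ← Real.log_inv, one_div]
      linarith [Real.log_le_sub_one_of_pos (inv_pos.2 hy0)]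
    have hinv0 : 0 ≤ 1 / Real.sqrt x := by positivity
    have hM : n + 1 ≤ ⌊1 / Real.sqrt x⌋₊ := by
      refine Nat.le_floor ?_
      rw [le_div_iff₀ hsx]; push_cast; exact hy.le
    obtain ⟨j, hj⟩ := Nat.exists_eq_add_of_le hM
    have hM1 : ((n + 1 + j : ℕ) : ℝ) ≤ 1 / Real.sqrt x := hj ▸ Nat.floor_le hinv0
    have hM2 : 1 / Real.sqrt x < ((n + 1 + j : ℕ) : ℝ) + 1 := hj ▸ Nat.lt_floor_add_one _
    have hx1' : Real.sqrt x < 1 := by nlinarith [(n.cast_nonneg : (0 : ℝ) ≤ n)]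
    have hfl : ∀ l : ℕ, (l : ℝ) ≤ 1 / Real.sqrt x → ⌊(l : ℝ) * x⌋₊ = 0 := by
      intro l hl
      rw [Nat.floor_eq_zero]
      rw [le_div_iff₀ hsx] at hl
      have : (l : ℝ) * x = l * Real.sqrt x * Real.sqrt x := by
        rw [mul_assoc, Real.mul_self_sqrt hx.le]
      nlinarith
    have hfn : ⌊(n : ℝ) * x⌋₊ = 0 := hfl n (by
      rw [le_div_iff₀ hsx]; nlinarith)
    have heq : errorTerm x n = errorTerm x (n + 1 + j)
        - (Fpart 1 (n + 1 + j) x 0 - Fpart 1 n x 0) := by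
      rw [errorTerm, errorTerm, hfn, hfl _ hM1]; ring
    have hb1 : ‖errorTerm x (n + 1 + j)‖ ≤ 16 + 16 * Real.exp 2 := by
      refine (norm_errorTerm_le hx hx1 _).trans (div_le_self (by positivity) ?_)
      rw [div_lt_iff₀ hsx] at hM2
      exact hM2.le
    have hb2 : ‖Fpart 1 (n + 1 + j) x 0 - Fpart 1 n x 0‖
        ≤ 1 + |Real.log ((n + 1) * Real.sqrt x)| := by
      refine (norm_Fpart_sub_le x n j).trans ?_
      have h3 := Real.log_le_log (by positivity) hM1
      rw [one_div, Real.log_inv] at h3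
      rw [abs_of_nonpos hlog, Real.log_mul hn1.ne' hsx.ne']
      linarith
    rw [heq]
    refine (norm_sub_le _ _).trans ?_
    have := abs_nonneg (Real.log ((n + 1) * Real.sqrt x))
    nlinarith

theorem Fpart_neg (n : ℕ) (x : ℝ) :
    Fpart 1 n (-x) 0 = (starRingEnd ℂ) (Fpart 1 n x 0) := by
  rw [Fpart_one, Fpart_one, map_sum]
  refine Finset.sum_congr rfl fun k _ => ?_
  rw [map_div₀, ← exp_conj]
  simp

theorem exp_sign_of_neg : exp (((-1 : ℝ) : ℂ) * Real.pi * I / 4) = (starRingEnd ℂ) ρ := by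
  rw [ρ, ← exp_conj]
  congr 1
  simp [map_ofNat]

/-- approximate functional equation with error term, case `s = 1`. -/
theorem stmt4 :
    ∃ C : ℝ, 0 < C ∧ ∀ x : ℝ, x ∈ Set.Icc (-1 : ℝ) 1 → x ≠ 0 → ∀ n : ℕ,
      ‖Fpart 1 n x 0
          - Complex.exp (Real.sign x * Real.pi * Complex.I / 4) * ((Real.sqrt |x| : ℝ) : ℂ)
            * Fpart 1 ⌊(n : ℝ) * |x|⌋₊ (-1 / x) 0
          - Omega0 1 x‖
        ≤ C * min (1 / (((n : ℝ) + 1) * Real.sqrt |x|))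
            (1 + |Real.log (((n : ℝ) + 1) * Real.sqrt |x|)|) := by

  refine ⟨17 + 16 * Real.exp 2, by positivity, fun x hx hx0 n => ?_⟩
  rcases lt_or_gt_of_ne hx0 with h | h
  · have hy : 0 < -x := by linarith
    have hconj : Fpart 1 n x 0
          - Complex.exp (Real.sign x * Real.pi * Complex.I / 4) * ((Real.sqrt |x| : ℝ) : ℂ)
            * Fpart 1 ⌊(n : ℝ) * |x|⌋₊ (-1 / x) 0
          - Omega0 1 x = (starRingEnd ℂ) (errorTerm (-x) n) := by
      have e1 : Fpart 1 n x 0 = (starRingEnd ℂ) (Fpart 1 n (-x) 0) := by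
        rw [← Fpart_neg, neg_neg]
      have e2 : Fpart 1 ⌊(n : ℝ) * -x⌋₊ (-1 / x) 0
          = (starRingEnd ℂ) (Fpart 1 ⌊(n : ℝ) * -x⌋₊ (-1 / -x) 0) := by
        rw [← Fpart_neg]; congr 1; rw [div_neg, neg_neg]
      rw [abs_of_neg h, Real.sign_of_neg h, exp_sign_of_neg, Omega0, Omega, if_neg (not_lt.2 h.le),
        e1, e2, errorTerm, neg_zero]
      simp only [map_sub, map_mul, conj_ofReal]
    rw [hconj, Complex.norm_conj, abs_of_neg h]
    exact norm_errorTerm_le_min hy (by linarith [hx.1]) n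
  · have heq : Fpart 1 n x 0
          - Complex.exp (Real.sign x * Real.pi * Complex.I / 4) * ((Real.sqrt |x| : ℝ) : ℂ)
            * Fpart 1 ⌊(n : ℝ) * |x|⌋₊ (-1 / x) 0
          - Omega0 1 x = errorTerm x n := by
      rw [abs_of_pos h, Real.sign_of_pos h, Omega0, Omega, if_pos h, errorTerm, ρ]
      simp
    rw [heq, abs_of_pos h]
    exact norm_errorTerm_le_min h hx.2 n
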